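/- arXiv:1509.06394 — 2 statements merged into one kernel-verified Lean document; each statement's English description precedes it below -/
import Mathlib

section
/- Suppose Q(G) is Archimedean and the Slater condition holds for the LSIPP problem (P). Let k ≥ d_P and let z* be an optimizer of the k-th moment relaxation. If there exists t ∈ ℕ with d_P ≤ t ≤ k and rank M_{t−d_S}(z*) = rank M_t(z*), then p^mom_k = p*. -/
open MvPolynomial

/-- A polynomial is a sum of squares. -/
def SOSPoly {n : ℕ} (p : MvPolynomial (Fin n) ℝ) : Prop :=
  ∃ (t : ℕ) (q : Fin t → MvPolynomial (Fin n) ℝ), p = ∑ i, q i ^ 2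

/-- Membership in the quadratic module Q(G) generated by `g`. -/
def QModMem {n s : ℕ} (g : Fin s → MvPolynomial (Fin n) ℝ)
    (p : MvPolynomial (Fin n) ℝ) : Prop :=
  ∃ (σ₀ : MvPolynomial (Fin n) ℝ) (σ : Fin s → MvPolynomial (Fin n) ℝ),
    SOSPoly σ₀ ∧ (∀ j, SOSPoly (σ j)) ∧ p = σ₀ + ∑ j, σ j * g j

/-- The basic semialgebraic index set S. -/
def indexSet {n s : ℕ} (g : Fin s → MvPolynomial (Fin n) ℝ) : Set (Fin n → ℝ) :=
  {y | ∀ j, 0 ≤ eval y (g j)}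

/-- Feasibility for the LSIPP problem (P): a(y)ᵀx + b(y) ≥ 0 for all y ∈ S. -/
def isFeasible {n m s : ℕ} (a : Fin m → MvPolynomial (Fin n) ℝ)
    (b : MvPolynomial (Fin n) ℝ) (g : Fin s → MvPolynomial (Fin n) ℝ)
    (x : Fin m → ℝ) : Prop :=
  ∀ y ∈ indexSet g, 0 ≤ (∑ i, x i * eval y (a i)) + eval y b

/-- The quadratic module Q(G) is Archimedean. -/
def QMArchimedean {n s : ℕ} (g : Fin s → MvPolynomial (Fin n) ℝ) : Prop :=
  ∃ ψ : MvPolynomial (Fin n) ℝ, QModMem g ψ ∧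
    IsCompact {y : Fin n → ℝ | 0 ≤ eval y ψ}

/-- Membership in the k-th truncated quadratic module Q_k(G). -/
def QModMemK {n s : ℕ} (g : Fin s → MvPolynomial (Fin n) ℝ) (k : ℕ)
    (p : MvPolynomial (Fin n) ℝ) : Prop :=
  ∃ (σ₀ : MvPolynomial (Fin n) ℝ) (σ : Fin s → MvPolynomial (Fin n) ℝ),
    SOSPoly σ₀ ∧ (∀ j, SOSPoly (σ j)) ∧ σ₀.totalDegree ≤ 2 * k ∧
    (∀ j, (σ j * g j).totalDegree ≤ 2 * k) ∧ p = σ₀ + ∑ j, σ j * g j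

/-- ⌈d/2⌉ for natural d. -/
def halfCeil (d : ℕ) : ℕ := (d + 1) / 2

/-- d_S = max{1, d_1, …, d_s}. -/
def dS {n s : ℕ} (g : Fin s → MvPolynomial (Fin n) ℝ) : ℕ :=
  max 1 (Finset.univ.sup fun j => halfCeil (g j).totalDegree)

/-- d_P = max{d_S, ⌈deg a_i / 2⌉, ⌈deg b / 2⌉}. -/
def dP {n m s : ℕ} (a : Fin m → MvPolynomial (Fin n) ℝ)
    (b : MvPolynomial (Fin n) ℝ) (g : Fin s → MvPolynomial (Fin n) ℝ) : ℕ :=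
  max (max (dS g) (Finset.univ.sup fun i => halfCeil (a i).totalDegree))
    (halfCeil b.totalDegree)

/-- The Riesz functional L_z(p) = Σ_α p_α z_α. -/
noncomputable def rieszFun {n : ℕ} (z : (Fin n →₀ ℕ) → ℝ)
    (p : MvPolynomial (Fin n) ℝ) : ℝ :=
  ∑ α ∈ p.support, p.coeff α * z α

/-- The finite set of multi-indices α with |α| ≤ t. -/
noncomputable def monLE (n t : ℕ) : Finset (Fin n →₀ ℕ) :=
  ((Fintype.piFinset fun _ : Fin n => Finset.range (t + 1)).filter
    fun a => ∑ i, a i ≤ t).image fun a => Finsupp.equivFunOnFinite.symm a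

/-- The moment matrix M_k(z), with (α,β)-entry z_{α+β} for |α|, |β| ≤ k. -/
noncomputable def momentMat (n k : ℕ) (z : (Fin n →₀ ℕ) → ℝ) :
    Matrix ↥(monLE n k) ↥(monLE n k) ℝ :=
  fun I J => z (I.1 + J.1)

/-- The localizing matrix M_t(f z), with (α,β)-entry Σ_γ f_γ z_{α+β+γ} for |α|, |β| ≤ t. -/
noncomputable def localizingMat (n t : ℕ) (f : MvPolynomial (Fin n) ℝ)
    (z : (Fin n →₀ ℕ) → ℝ) :
    Matrix ↥(monLE n t) ↥(monLE n t) ℝ :=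
  fun I J => ∑ γ ∈ f.support, f.coeff γ * z (I.1 + J.1 + γ)

/-- Feasibility for the k-th moment relaxation. -/
def momFeas {n m s : ℕ} (c : Fin m → ℝ) (a : Fin m → MvPolynomial (Fin n) ℝ)
    (g : Fin s → MvPolynomial (Fin n) ℝ) (k : ℕ) (z : (Fin n →₀ ℕ) → ℝ) : Prop :=
  (∀ i, rieszFun z (a i) = c i) ∧ (momentMat n k z).PosSemidef ∧
    ∀ j, (localizingMat n (k - halfCeil (g j).totalDegree) (g j) z).PosSemidef

/-- The k-th moment relaxation value p^mom_k (as an extended real, −∞ if infeasible). -/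
noncomputable def pmom {n m s : ℕ} (c : Fin m → ℝ) (a : Fin m → MvPolynomial (Fin n) ℝ)
    (b : MvPolynomial (Fin n) ℝ) (g : Fin s → MvPolynomial (Fin n) ℝ) (k : ℕ) : EReal :=
  sSup ((fun z : (Fin n →₀ ℕ) → ℝ => ((-(rieszFun z b) : ℝ) : EReal)) ''
    {z | momFeas c a g k z})

/-- In a finite-dimensional real space, the convex hull of a compact set is compact. -/
theorem IsCompact.convexHull_of_finiteDimensional {E : Type*} [NormedAddCommGroup E]
    [NormedSpace ℝ E] [FiniteDimensional ℝ E] {s : Set E} (hs : IsCompact s) :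
    IsCompact (convexHull ℝ s) := by
  have key : convexHull ℝ s = ⋃ k ∈ Set.Iic (Module.finrank ℝ E + 1),
      (fun p : (Fin k → ℝ) × (Fin k → E) => ∑ i, p.1 i • p.2 i) ''
        (stdSimplex ℝ (Fin k) ×ˢ Set.univ.pi fun _ => s) := by
    apply Set.Subset.antisymm
    · intro x hx
      obtain ⟨ι, _, z, w, hz, hind, hw, hw1, hx⟩ := eq_pos_convex_span_of_mem_convexHull hx
      let e := Fintype.equivFin ι
      have hcard : Fintype.card ι ≤ Module.finrank ℝ E + 1 :=
        hind.card_le_finrank_succ.trans (by gcongr; exact Submodule.finrank_le _)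
      refine Set.mem_biUnion hcard ⟨(w ∘ e.symm, z ∘ e.symm), ⟨⟨fun i => (hw _).le, ?_⟩, ?_⟩, ?_⟩
      · simpa using (Equiv.sum_comp e.symm w).trans hw1
      · exact fun i _ => hz ⟨_, rfl⟩
      · simpa using (Equiv.sum_comp e.symm fun i => w i • z i).trans hx
    · simp only [Set.iUnion_subset_iff]
      rintro k - _ ⟨⟨w, z⟩, ⟨⟨hw, hw1⟩, hz⟩, rfl⟩
      exact (convex_convexHull ℝ s).sum_mem (fun i _ => hw i) hw1
        fun i _ => subset_convexHull ℝ s (hz i trivial)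
  rw [key]
  refine (Set.finite_Iic _).isCompact_biUnion fun k _ => ?_
  refine ((isCompact_stdSimplex ℝ (Fin k)).prod (isCompact_univ_pi fun _ => hs)).image ?_
  fun_prop

/-- A family of symmetric commuting operators on a finite-dimensional space splits every vector
into joint eigenvectors. -/
theorem exists_joint_eigenvector_decomposition {ι H : Type*} [Finite ι] [NormedAddCommGroup H]
    [InnerProductSpace ℝ H] [FiniteDimensional ℝ H] (T : ι → H →ₗ[ℝ] H)
    (hsymm : ∀ i, (T i).IsSymmetric) (hcomm : ∀ i j, Commute (T i) (T j)) (u : H) :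
    ∃ e : (ι → ℝ) →₀ H, (∀ v i, T i (e v) = v i • e v) ∧
      (∀ v w, v ≠ w → inner ℝ (e v) (e w) = 0) ∧ ∑ v ∈ e.support, e v = u := by
  have htop := LinearMap.IsSymmetric.iSup_iInf_eq_top_of_commute hsymm
    fun i j _ => hcomm i j
  have hu : u ∈ ⨆ χ : ι → ℝ, ⨅ i, Module.End.eigenspace (T i) (χ i) := htop ▸ Submodule.mem_top
  obtain ⟨e, he, hsum⟩ := (Submodule.mem_iSup_iff_exists_finsupp _ _).1 hu
  refine ⟨e, fun v i => ?_, fun v w hvw => ?_, hsum⟩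
  · exact Module.End.mem_eigenspace_iff.1 ((Submodule.mem_iInf _).1 (he v) i)
  · exact LinearMap.IsSymmetric.orthogonalFamily_iInf_eigenspaces hsymm hvw ⟨_, he v⟩ ⟨_, he w⟩

/-- Linear maps that agree on monomials of degree at most `d` agree on polynomials of degree at
most `d`. -/
theorem eq_of_eq_on_monomials {n d : ℕ} {M : Type*} [AddCommGroup M] [Module ℝ M]
    {f g : MvPolynomial (Fin n) ℝ →ₗ[ℝ] M}
    (h : ∀ α : Fin n →₀ ℕ, α.degree ≤ d → f (monomial α 1) = g (monomial α 1))
    {p : MvPolynomial (Fin n) ℝ} (hp : p.totalDegree ≤ d) : f p = g p := by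
  have hsp : p = ∑ α ∈ p.support, p.coeff α • monomial α (1 : ℝ) := by
    simp [smul_monomial]
  rw [hsp, map_sum, map_sum]
  refine Finset.sum_congr rfl fun α hα => ?_
  rw [map_smul, map_smul, h α ((le_totalDegree hα).trans hp)]

/-- The flat extension theorem in the language of a Gram representation: a linear functional on
polynomials of degree at most `2 * t` that is given by inner products of vectors already spanned
by polynomials of degree at most `t - d` is a finite positive combination of point evaluations,
and the points are separated by polynomials of degree at most `t - d`. -/
theorem exists_atomic_of_flat {n : ℕ} {H : Type*} [NormedAddCommGroup H]
    [InnerProductSpace ℝ H] [FiniteDimensional ℝ H] (L : MvPolynomial (Fin n) ℝ →ₗ[ℝ] ℝ)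
    (Φ : MvPolynomial (Fin n) ℝ →ₗ[ℝ] H) {t d : ℕ} (hd : 1 ≤ d) (hdt : d ≤ t)
    (hinner : ∀ p q : MvPolynomial (Fin n) ℝ, p.totalDegree ≤ t → q.totalDegree ≤ t →
      inner ℝ (Φ p) (Φ q) = L (p * q))
    (hsurj : ∀ h : H, ∃ p : MvPolynomial (Fin n) ℝ, p.totalDegree ≤ t - d ∧ Φ p = h) :
    ∃ (A : Finset (Fin n → ℝ)) (r : (Fin n → ℝ) → ℝ), (∀ v ∈ A, 0 < r v) ∧
      (∀ f : MvPolynomial (Fin n) ℝ, f.totalDegree ≤ 2 * t → L f = ∑ v ∈ A, r v * eval v f) ∧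
      ∀ v ∈ A, ∃ p : MvPolynomial (Fin n) ℝ, p.totalDegree ≤ t - d ∧ eval v p = 1 ∧
        ∀ w ∈ A, w ≠ v → eval w p = 0 := by
  classical
  -- a linear section of `Φ` with values in degree at most `t - 1`
  obtain ⟨σ, hσdeg, hσ⟩ : ∃ σ : H →ₗ[ℝ] MvPolynomial (Fin n) ℝ,
      (∀ h, (σ h).totalDegree ≤ t - 1) ∧ ∀ h, Φ (σ h) = h := by
    let V := restrictTotalDegree (Fin n) ℝ (t - 1)
    obtain ⟨σ, hσ⟩ := (Φ.domRestrict V).exists_rightInverse_of_surjective <| by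
      rw [LinearMap.range_eq_top]
      intro h
      obtain ⟨p, hp, rfl⟩ := hsurj h
      exact ⟨⟨p, (mem_restrictTotalDegree _ _ _).2 (hp.trans (by omega))⟩, rfl⟩
    exact ⟨V.subtype ∘ₗ σ, fun h => (mem_restrictTotalDegree _ _ _).1 (σ h).2,
      fun h => LinearMap.congr_fun hσ h⟩
  have hX : ∀ i (p : MvPolynomial (Fin n) ℝ), p.totalDegree ≤ t - 1 →
      (X i * p).totalDegree ≤ t := fun i p hp => by
    refine (totalDegree_mul _ _).trans ?_
    rw [totalDegree_X]
    omega
  have hle : ∀ p : MvPolynomial (Fin n) ℝ, p.totalDegree ≤ t - 1 → p.totalDegree ≤ t :=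
    fun p hp => hp.trans (Nat.sub_le _ _)
  let T : Fin n → H →ₗ[ℝ] H := fun i => Φ ∘ₗ LinearMap.mulLeft ℝ (X i) ∘ₗ σ
  have hTdef : ∀ i h, T i h = Φ (X i * σ h) := fun i h => rfl
  have hT : ∀ i (p : MvPolynomial (Fin n) ℝ), p.totalDegree ≤ t - 1 →
      T i (Φ p) = Φ (X i * p) := by
    intro i p hp
    rw [hTdef]
    refine ext_inner_right ℝ fun h => ?_
    have h1 := hinner (X i * σ (Φ p)) (σ h) (hX i _ (hσdeg _)) (hle _ (hσdeg _))
    have h2 := hinner (X i * p) (σ h) (hX i _ hp) (hle _ (hσdeg _))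
    have h3 := hinner (σ (Φ p)) (X i * σ h) (hle _ (hσdeg _)) (hX i _ (hσdeg _))
    have h4 := hinner p (X i * σ h) (hle _ hp) (hX i _ (hσdeg _))
    rw [hσ] at h1 h2 h3
    rw [h1, h2, mul_assoc, mul_left_comm, ← h3, h4, mul_left_comm, mul_assoc]
  have hsymm : ∀ i, (T i).IsSymmetric := by
    intro i h h'
    have h1 := hinner (X i * σ h) (σ h') (hX i _ (hσdeg _)) (hle _ (hσdeg _))
    have h2 := hinner (σ h) (X i * σ h') (hle _ (hσdeg _)) (hX i _ (hσdeg _))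
    rw [hσ] at h1 h2
    rw [hTdef, hTdef, h1, h2, mul_assoc, mul_left_comm]
  have hcomm : ∀ i j, Commute (T i) (T j) := by
    intro i j
    refine LinearMap.ext fun h => ext_inner_right ℝ fun h' => ?_
    rw [Module.End.mul_apply, Module.End.mul_apply, hsymm i (T j h) h', hsymm j (T i h) h', hTdef,
      hTdef, hTdef, hTdef,
      hinner _ _ (hX j _ (hσdeg _)) (hX i _ (hσdeg _)),
      hinner _ _ (hX i _ (hσdeg _)) (hX j _ (hσdeg _))]
    congr 1
    ring
  obtain ⟨e, heig, horth, hsum⟩ := exists_joint_eigenvector_decomposition T hsymm hcomm (Φ 1)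
  have hmon : ∀ (k : ℕ), k ≤ t → ∀ α : Fin n →₀ ℕ, α.degree = k →
      Φ (monomial α 1) = ∑ v ∈ e.support, eval v (monomial α (1 : ℝ)) • e v := by
    intro k
    induction k with
    | zero =>
      intro _ α hα
      rw [(Finsupp.degree_eq_zero_iff α).1 hα]
      simpa using hsum.symm
    | succ k ih =>
      intro hk α hα
      obtain ⟨i, hi⟩ : ∃ i, α i ≠ 0 := by
        by_contra! h
        have : α = 0 := Finsupp.ext h
        simp [this] at hα
      obtain ⟨β, rfl⟩ : ∃ β, α = Finsupp.single i 1 + β :=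
        ⟨α - Finsupp.single i 1, by
          rw [add_tsub_cancel_of_le]; simpa [Nat.one_le_iff_ne_zero] using hi⟩
      have hβ : β.degree = k := by
        rw [map_add, Finsupp.degree_single] at hα
        omega
      have hm : monomial (Finsupp.single i 1 + β) (1 : ℝ) = X i * monomial β 1 := by
        rw [X, monomial_mul, one_mul]
      have hdeg : (monomial β (1 : ℝ)).totalDegree ≤ t - 1 := by
        rw [totalDegree_monomial _ one_ne_zero]
        change β.degree ≤ _
        omega
      rw [hm, ← hT i _ hdeg, ih (by omega) β hβ, map_sum]
      refine Finset.sum_congr rfl fun v _ => ?_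
      rw [map_smul, heig, smul_smul, map_mul, eval_X, mul_comm]
  have hΦ : ∀ p : MvPolynomial (Fin n) ℝ, p.totalDegree ≤ t →
      Φ p = ∑ v ∈ e.support, eval v p • e v := by
    intro p hp
    have := eq_of_eq_on_monomials (f := Φ)
      (g := ∑ v ∈ e.support, (aeval v).toLinearMap.smulRight (e v))
      (fun α hα => by simpa [aeval_eq_eval] using hmon α.degree hα α rfl) hp
    simpa [aeval_eq_eval] using this
  have hL2 : ∀ p q : MvPolynomial (Fin n) ℝ, p.totalDegree ≤ t → q.totalDegree ≤ t →
      L (p * q) = ∑ v ∈ e.support, ‖e v‖ ^ 2 * eval v (p * q) := by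
    intro p q hp hq
    rw [← hinner p q hp hq, hΦ p hp, hΦ q hq, sum_inner]
    refine Finset.sum_congr rfl fun v hv => ?_
    rw [inner_sum, Finset.sum_eq_single_of_mem v hv]
    · rw [real_inner_smul_left, real_inner_smul_right, real_inner_self_eq_norm_sq, map_mul]
      ring
    · intro w _ hw
      rw [real_inner_smul_left, real_inner_smul_right, horth v w hw.symm]
      simp
  refine ⟨e.support, fun v => ‖e v‖ ^ 2, fun v hv => ?_, fun f hf => ?_, fun v hv => ?_⟩
  · have := Finsupp.mem_support_iff.1 hv
    positivity
  · have := eq_of_eq_on_monomials (f := L)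
      (g := ∑ v ∈ e.support, ‖e v‖ ^ 2 • (aeval v).toLinearMap) (fun α hα' => by
        obtain ⟨β, hβα, hβ⟩ := Finsupp.exists_le_degree_eq α (min t α.degree) (min_le_right _ _)
        obtain ⟨γ, rfl⟩ := exists_add_of_le hβα
        rw [map_add] at hα' hβ
        have hm : monomial (β + γ) (1 : ℝ) = monomial β 1 * monomial γ 1 := by
          rw [monomial_mul, one_mul]
        have := hL2 (monomial β 1) (monomial γ 1)
          (by
            rw [totalDegree_monomial _ one_ne_zero]
            change β.degree ≤ _
            omega)
          (by
            rw [totalDegree_monomial _ one_ne_zero]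
            change γ.degree ≤ _
            omega)
        rw [hm, this]
        simp [aeval_eq_eval]) hf
    simpa [aeval_eq_eval] using this
  · obtain ⟨p, hp, hpv⟩ := hsurj (e v)
    have hexp := hΦ p (hp.trans (Nat.sub_le _ _))
    have hw : ∀ w ∈ e.support, inner ℝ (e v) (e w) = eval w p * ‖e w‖ ^ 2 := by
      intro w hw
      rw [← hpv, hexp, sum_inner, Finset.sum_eq_single_of_mem w hw]
      · rw [real_inner_smul_left, real_inner_self_eq_norm_sq]
      · intro w' _ hne
        rw [real_inner_smul_left, horth w' w hne, mul_zero]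
    have hpos : ∀ w ∈ e.support, ‖e w‖ ^ 2 ≠ 0 := fun w hw => by
      have := Finsupp.mem_support_iff.1 hw
      positivity
    refine ⟨p, hp, ?_, fun w hwA hne => ?_⟩
    · have := hw v hv
      rw [real_inner_self_eq_norm_sq] at this
      exact (mul_eq_right₀ (hpos v hv)).1 this.symm
    · have := hw w hwA
      rw [horth v w hne.symm] at this
      exact (mul_eq_zero.1 this.symm).resolve_right (hpos w hwA)

theorem mem_monLE {n t : ℕ} {α : Fin n →₀ ℕ} : α ∈ monLE n t ↔ α.degree ≤ t := by
  simp only [monLE, Finset.mem_image, Finset.mem_filter, Fintype.mem_piFinset, Finset.mem_range,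
    Finsupp.degree_eq_sum]
  constructor
  · rintro ⟨f, ⟨-, hf⟩, rfl⟩
    simpa using hf
  · intro h
    refine ⟨α, ⟨fun i => ?_, h⟩, by ext; simp⟩
    exact Nat.lt_succ_of_le ((Finset.single_le_sum (fun _ _ => Nat.zero_le _)
      (Finset.mem_univ i)).trans h)

/-- The Riesz functional as a linear map. -/
noncomputable def rieszLin {n : ℕ} (z : (Fin n →₀ ℕ) → ℝ) : MvPolynomial (Fin n) ℝ →ₗ[ℝ] ℝ :=
  (basisMonomials (Fin n) ℝ).constr ℝ z

theorem rieszLin_monomial {n : ℕ} (z : (Fin n →₀ ℕ) → ℝ) (α : Fin n →₀ ℕ) :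
    rieszLin z (monomial α 1) = z α :=
  (basisMonomials (Fin n) ℝ).constr_basis ℝ z α

theorem rieszLin_monomial_mul {n : ℕ} (z : (Fin n →₀ ℕ) → ℝ) (α : Fin n →₀ ℕ)
    (f : MvPolynomial (Fin n) ℝ) :
    rieszLin z (monomial α 1 * f) = ∑ γ ∈ f.support, f.coeff γ * z (α + γ) := by
  have hsp : f = ∑ γ ∈ f.support, f.coeff γ • monomial γ (1 : ℝ) := by simp [smul_monomial]
  conv_lhs => rw [hsp]
  simp only [Finset.mul_sum, map_sum, mul_smul_comm, map_smul, monomial_mul, one_mul,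
    rieszLin_monomial, smul_eq_mul]

theorem rieszFun_eq_rieszLin {n : ℕ} (z : (Fin n →₀ ℕ) → ℝ) (p : MvPolynomial (Fin n) ℝ) :
    rieszFun z p = rieszLin z p := by
  have := rieszLin_monomial_mul z 0 p
  rw [← one_def, one_mul] at this
  simp [this, rieszFun]

theorem rieszLin_sq_mul_nonneg {n t : ℕ} {z : (Fin n →₀ ℕ) → ℝ} {f p : MvPolynomial (Fin n) ℝ}
    (hf : (localizingMat n t f z).PosSemidef) (hp : p.totalDegree ≤ t) :
    0 ≤ rieszLin z (p ^ 2 * f) := by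
  have hsp : p = ∑ I : monLE n t, p.coeff I.1 • monomial I.1 (1 : ℝ) := by
    rw [Finset.sum_coe_sort (monLE n t) fun α => p.coeff α • monomial α (1 : ℝ)]
    simp only [smul_monomial, smul_eq_mul, mul_one]
    conv_lhs => rw [p.as_sum]
    refine Finset.sum_subset (fun α hα => mem_monLE.2 ((le_totalDegree hα).trans hp))
      fun α _ hα => ?_
    rw [notMem_support_iff.1 hα, monomial_zero]
  have hnn := hf.dotProduct_mulVec_nonneg fun I => p.coeff I.1
  have hexp : rieszLin z (p ^ 2 * f) = rieszLin z
      ((∑ I : monLE n t, p.coeff I.1 • monomial I.1 (1 : ℝ)) *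
        ((∑ I : monLE n t, p.coeff I.1 • monomial I.1 (1 : ℝ)) * f)) := by
    rw [← hsp, pow_two, mul_assoc]
  rw [hexp]
  suffices h : rieszLin z
      ((∑ I : monLE n t, p.coeff I.1 • monomial I.1 (1 : ℝ)) *
        ((∑ I : monLE n t, p.coeff I.1 • monomial I.1 (1 : ℝ)) * f)) = _ from hnn.trans_eq h.symm
  simp only [Finset.sum_mul, Finset.mul_sum, map_sum, smul_mul_assoc, mul_smul_comm, map_smul,
    ← mul_assoc, monomial_mul, one_mul, rieszLin_monomial_mul, dotProduct, Matrix.mulVec, localizingMat,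
    smul_eq_mul]
  rw [Finset.sum_comm]
  refine Finset.sum_congr rfl fun I _ => Finset.sum_congr rfl fun J _ =>
    Finset.sum_congr rfl fun γ _ => ?_
  simp only [Pi.star_apply, star_trivial]
  rw [add_comm I.1 J.1]
  ring

open scoped MatrixOrder in
/-- A positive semidefinite real matrix is a Gram matrix. -/
theorem Matrix.PosSemidef.exists_eq_gram {ι : Type*} [Fintype ι] {M : Matrix ι ι ℝ}
    (hM : M.PosSemidef) : ∃ v : ι → EuclideanSpace ℝ ι, M = Matrix.gram ℝ v := by
  classical
  obtain ⟨B, hB⟩ := CStarAlgebra.nonneg_iff_eq_star_mul_self.mp hM.nonneg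
  refine ⟨fun j => WithLp.toLp 2 (B.col j), ?_⟩
  rw [hB, Matrix.gram_eq_conjTranspose_mul (EuclideanSpace.basisFun ι ℝ)]
  rfl

theorem Matrix.rank_gram {ι E : Type*} [Fintype ι] [NormedAddCommGroup E]
    [InnerProductSpace ℝ E] [FiniteDimensional ℝ E] (v : ι → E) :
    (Matrix.gram ℝ v).rank = Module.finrank ℝ (Submodule.span ℝ (Set.range v)) := by
  classical
  let b := stdOrthonormalBasis ℝ E
  let φ := b.repr.toLinearEquiv.trans (WithLp.linearEquiv 2 ℝ _)
  rw [Matrix.gram_eq_conjTranspose_mul b, Matrix.rank_conjTranspose_mul_self,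
    Matrix.rank_eq_finrank_span_cols, ← LinearEquiv.finrank_map_eq φ, Submodule.map_span,
    ← Set.range_comp]
  rfl

/-- The flat extension theorem: under the rank condition the Riesz functional is, in degree at
most `2 * t`, a finite positive combination of point evaluations which are separated by
polynomials of degree at most `t - d`. -/
theorem exists_atomic_of_rank_eq {n t d : ℕ} {z : (Fin n →₀ ℕ) → ℝ} (hd : 1 ≤ d) (hdt : d ≤ t)
    (hpsd : (momentMat n t z).PosSemidef)
    (hrank : (momentMat n (t - d) z).rank = (momentMat n t z).rank) :
    ∃ (A : Finset (Fin n → ℝ)) (r : (Fin n → ℝ) → ℝ), (∀ v ∈ A, 0 < r v) ∧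
      (∀ f : MvPolynomial (Fin n) ℝ, f.totalDegree ≤ 2 * t →
        rieszLin z f = ∑ v ∈ A, r v * eval v f) ∧
      ∀ v ∈ A, ∃ p : MvPolynomial (Fin n) ℝ, p.totalDegree ≤ t - d ∧ eval v p = 1 ∧
        ∀ w ∈ A, w ≠ v → eval w p = 0 := by
  classical
  obtain ⟨v, hv⟩ := hpsd.exists_eq_gram
  let ι : monLE n (t - d) → monLE n t := fun I =>
    ⟨I.1, mem_monLE.2 ((mem_monLE.1 I.2).trans (Nat.sub_le _ _))⟩
  have hv' : momentMat n (t - d) z = Matrix.gram ℝ (v ∘ ι) := by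
    ext I J
    exact congr_fun (congr_fun hv (ι I)) (ι J)
  let H := Submodule.span ℝ (Set.range v)
  have hspan : Submodule.span ℝ (Set.range (v ∘ ι)) = H := by
    refine Submodule.eq_of_le_of_finrank_eq (Submodule.span_mono (Set.range_comp_subset_range _ _))
      ?_
    rw [← Matrix.rank_gram, ← Matrix.rank_gram, ← hv, ← hv', hrank]
  let w : (Fin n →₀ ℕ) → H := fun α =>
    if h : α ∈ monLE n t then ⟨v ⟨α, h⟩, Submodule.subset_span ⟨_, rfl⟩⟩ else 0
  have hw : ∀ I : monLE n t, (w I.1 : EuclideanSpace ℝ (monLE n t)) = v I := fun I => by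
    simp only [w, dif_pos I.2]
  let Φ := (basisMonomials (Fin n) ℝ).constr ℝ w
  have hΦ : ∀ α, Φ (monomial α 1) = w α := (basisMonomials (Fin n) ℝ).constr_basis ℝ w
  refine exists_atomic_of_flat (rieszLin z) Φ hd hdt (fun p q hp hq => ?_) fun h => ?_
  · refine eq_of_eq_on_monomials (f := innerₗ H (Φ p) ∘ₗ Φ)
      (g := rieszLin z ∘ₗ LinearMap.mulLeft ℝ p) (fun β hβ => ?_) hq
    refine eq_of_eq_on_monomials (f := (innerₗ H).flip (Φ (monomial β 1)) ∘ₗ Φ)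
      (g := rieszLin z ∘ₗ LinearMap.mulRight ℝ (monomial β 1)) (fun α hα => ?_) hp
    simp only [LinearMap.comp_apply, LinearMap.flip_apply, innerₗ_apply_apply, hΦ,
      LinearMap.mulRight_apply, monomial_mul, one_mul, rieszLin_monomial, Submodule.coe_inner]
    rw [hw ⟨α, mem_monLE.2 hα⟩, hw ⟨β, mem_monLE.2 hβ⟩]
    exact (congr_fun (congr_fun hv ⟨α, mem_monLE.2 hα⟩) ⟨β, mem_monLE.2 hβ⟩).symm
  · obtain ⟨x, hx⟩ := (Submodule.mem_span_range_iff_exists_fun ℝ).1 (hspan.ge h.2)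
    refine ⟨∑ I, x I • monomial I.1 (1 : ℝ), ?_, Subtype.ext ?_⟩
    · refine totalDegree_finsetSum_le fun I _ => (totalDegree_smul_le _ _).trans ?_
      rw [totalDegree_monomial _ one_ne_zero]
      exact mem_monLE.1 I.2
    · rw [← hx, map_sum, Submodule.coe_sum]
      refine Finset.sum_congr rfl fun I _ => ?_
      rw [map_smul, hΦ, Submodule.coe_smul]
      exact congr_arg (x I • ·) (hw (ι I))

theorem le_two_mul_halfCeil (d : ℕ) : d ≤ 2 * halfCeil d := by
  unfold halfCeil
  omega

theorem one_le_dS {n s : ℕ} (g : Fin s → MvPolynomial (Fin n) ℝ) : 1 ≤ dS g :=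
  le_max_left _ _

theorem halfCeil_le_dS {n s : ℕ} (g : Fin s → MvPolynomial (Fin n) ℝ) (j : Fin s) :
    halfCeil (g j).totalDegree ≤ dS g :=
  (Finset.le_sup (f := fun j => halfCeil (g j).totalDegree) (Finset.mem_univ j)).trans
    (le_max_right _ _)

theorem momentMat_posSemidef_mono {n t k : ℕ} {z : (Fin n →₀ ℕ) → ℝ} (htk : t ≤ k)
    (h : (momentMat n k z).PosSemidef) : (momentMat n t z).PosSemidef :=
  h.submatrix fun I : monLE n t =>
    (⟨I.1, mem_monLE.2 ((mem_monLE.1 I.2).trans htk)⟩ : monLE n k)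

/-- Under the rank condition the Riesz functional is nonnegative on polynomials of degree at most
`2 * t` that are nonnegative on the index set. -/
theorem rieszLin_nonneg_of_flat {n s : ℕ} {g : Fin s → MvPolynomial (Fin n) ℝ} {t k : ℕ}
    {z : (Fin n →₀ ℕ) → ℝ} (hpsd : (momentMat n k z).PosSemidef)
    (hloc : ∀ j, (localizingMat n (k - halfCeil (g j).totalDegree) (g j) z).PosSemidef)
    (hdt : dS g ≤ t) (htk : t ≤ k)
    (hrank : (momentMat n (t - dS g) z).rank = (momentMat n t z).rank)
    {f : MvPolynomial (Fin n) ℝ} (hf : f.totalDegree ≤ 2 * t)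
    (hnonneg : ∀ y ∈ indexSet g, 0 ≤ eval y f) : 0 ≤ rieszLin z f := by
  obtain ⟨A, r, hr, hL, hsep⟩ := exists_atomic_of_rank_eq (one_le_dS g) hdt
    (momentMat_posSemidef_mono htk hpsd) hrank
  rw [hL f hf]
  refine Finset.sum_nonneg fun v hv => mul_nonneg (hr v hv).le (hnonneg v fun j => ?_)
  obtain ⟨p, hp, hpv, hpw⟩ := hsep v hv
  have hj := halfCeil_le_dS g j
  have hpos := rieszLin_sq_mul_nonneg (hloc j) (p := p) (by omega)
  have hdeg : (p ^ 2 * g j).totalDegree ≤ 2 * t := by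
    have h1 := totalDegree_mul (p ^ 2) (g j)
    have h2 := totalDegree_pow p 2
    have h3 := le_two_mul_halfCeil (g j).totalDegree
    omega
  rw [hL _ hdeg, Finset.sum_eq_single_of_mem v hv fun w hw hne => by simp [hpw w hw hne]] at hpos
  simp only [map_mul, map_pow, hpv, one_pow, one_mul] at hpos
  exact nonneg_of_mul_nonneg_right hpos (hr v hv)

theorem rieszFun_add {n : ℕ} (z z' : (Fin n →₀ ℕ) → ℝ) (p : MvPolynomial (Fin n) ℝ) :
    rieszFun (z + z') p = rieszFun z p + rieszFun z' p := by
  simp only [rieszFun, Pi.add_apply, mul_add, Finset.sum_add_distrib]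

theorem rieszFun_smul {n : ℕ} (r : ℝ) (z : (Fin n →₀ ℕ) → ℝ) (p : MvPolynomial (Fin n) ℝ) :
    rieszFun (r • z) p = r * rieszFun z p := by
  simp only [rieszFun, Pi.smul_apply, smul_eq_mul, Finset.mul_sum, mul_left_comm]

theorem localizingMat_add {n t : ℕ} (f : MvPolynomial (Fin n) ℝ) (z z' : (Fin n →₀ ℕ) → ℝ) :
    localizingMat n t f (z + z') = localizingMat n t f z + localizingMat n t f z' := by
  ext I J
  simp only [localizingMat, Matrix.add_apply, Pi.add_apply, mul_add, Finset.sum_add_distrib]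

theorem localizingMat_smul {n t : ℕ} (f : MvPolynomial (Fin n) ℝ) (r : ℝ)
    (z : (Fin n →₀ ℕ) → ℝ) : localizingMat n t f (r • z) = r • localizingMat n t f z := by
  ext I J
  simp only [localizingMat, Matrix.smul_apply, Pi.smul_apply, smul_eq_mul, Finset.mul_sum,
    mul_left_comm]

theorem momFeas_add {n m s k : ℕ} {c c' : Fin m → ℝ} {a : Fin m → MvPolynomial (Fin n) ℝ}
    {g : Fin s → MvPolynomial (Fin n) ℝ} {z z' : (Fin n →₀ ℕ) → ℝ} (h : momFeas c a g k z)
    (h' : momFeas c' a g k z') : momFeas (c + c') a g k (z + z') :=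
  ⟨fun i => by rw [rieszFun_add, h.1, h'.1, Pi.add_apply], h.2.1.add h'.2.1,
    fun j => localizingMat_add (g j) z z' ▸ (h.2.2 j).add (h'.2.2 j)⟩

theorem momFeas_smul {n m s k : ℕ} {c : Fin m → ℝ} {a : Fin m → MvPolynomial (Fin n) ℝ}
    {g : Fin s → MvPolynomial (Fin n) ℝ} {z : (Fin n →₀ ℕ) → ℝ} (h : momFeas c a g k z)
    {r : ℝ} (hr : 0 ≤ r) : momFeas (r • c) a g k (r • z) :=
  ⟨fun i => by rw [rieszFun_smul, h.1, Pi.smul_apply, smul_eq_mul], h.2.1.smul hr,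
    fun j => localizingMat_smul (g j) r z ▸ (h.2.2 j).smul hr⟩

/-- The moment sequence of the Dirac measure at `y`. -/
noncomputable def diracMoments {n : ℕ} (y : Fin n → ℝ) (α : Fin n →₀ ℕ) : ℝ :=
  eval y (monomial α 1)

theorem diracMoments_add {n : ℕ} (y : Fin n → ℝ) (α β : Fin n →₀ ℕ) :
    diracMoments y (α + β) = diracMoments y α * diracMoments y β := by
  rw [diracMoments, diracMoments, diracMoments, ← map_mul, monomial_mul, one_mul]

theorem rieszFun_diracMoments {n : ℕ} (y : Fin n → ℝ) (p : MvPolynomial (Fin n) ℝ) :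
    rieszFun (diracMoments y) p = eval y p := by
  rw [rieszFun_eq_rieszLin]
  have := eq_of_eq_on_monomials (f := rieszLin (diracMoments y)) (g := (aeval y).toLinearMap)
    (fun α _ => by simp [rieszLin_monomial, diracMoments, aeval_eq_eval]) (le_refl p.totalDegree)
  simpa [aeval_eq_eval] using this

theorem momFeas_diracMoments {n m s k : ℕ} (a : Fin m → MvPolynomial (Fin n) ℝ)
    {g : Fin s → MvPolynomial (Fin n) ℝ} {y : Fin n → ℝ} (hy : y ∈ indexSet g) :
    momFeas (fun i => eval y (a i)) a g k (diracMoments y) := by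
  refine ⟨fun i => rieszFun_diracMoments y (a i), ?_, fun j => ?_⟩
  · convert Matrix.posSemidef_vecMulVec_self_star fun I : monLE n k => diracMoments y I.1 using 1
    ext I J
    exact diracMoments_add y _ _
  · convert (Matrix.posSemidef_vecMulVec_self_star fun I : monLE n
      (k - halfCeil (g j).totalDegree) => diracMoments y I.1).smul (hy j) using 1
    ext I J
    simp only [localizingMat, Matrix.smul_apply, Matrix.vecMulVec_apply, star_trivial,
      diracMoments_add, smul_eq_mul, ← rieszFun_diracMoments y (g j), rieszFun, Finset.sum_mul]
    exact Finset.sum_congr rfl fun γ _ => by ring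

theorem SOSPoly.eval_nonneg {n : ℕ} {p : MvPolynomial (Fin n) ℝ} (hp : SOSPoly p)
    (y : Fin n → ℝ) : 0 ≤ eval y p := by
  obtain ⟨t, q, rfl⟩ := hp
  simp only [map_sum, map_pow]
  positivity

theorem isCompact_indexSet {n s : ℕ} {g : Fin s → MvPolynomial (Fin n) ℝ}
    (h : QMArchimedean g) : IsCompact (indexSet g) := by
  obtain ⟨ψ, ⟨σ₀, σ, h₀, hσ, rfl⟩, hc⟩ := h
  refine hc.of_isClosed_subset ?_ fun y hy => ?_
  · simp only [indexSet, Set.ofPred_forall]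
    exact isClosed_iInter fun j => isClosed_le continuous_const (continuous_eval (g j))
  · simp only [Set.mem_ofPred_eq, map_add, map_sum, map_mul]
    exact add_nonneg (h₀.eval_nonneg y)
      (Finset.sum_nonneg fun j _ => mul_nonneg ((hσ j).eval_nonneg y) (hy j))

/-- Under compactness of the index set and the Slater condition, every value strictly below the
optimal value of the semi-infinite program is dominated by a feasible moment sequence. -/
theorem exists_momFeas_of_slater {n m s : ℕ} {c : Fin m → ℝ}
    {a : Fin m → MvPolynomial (Fin n) ℝ} {b : MvPolynomial (Fin n) ℝ}
    {g : Fin s → MvPolynomial (Fin n) ℝ} (hS : IsCompact (indexSet g)) {x₀ : Fin m → ℝ}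
    (hx₀ : ∀ y ∈ indexSet g, 0 < (∑ i, x₀ i * eval y (a i)) + eval y b) {q : ℝ}
    (hq : ∀ x, isFeasible a b g x → q < ∑ i, c i * x i) (k : ℕ) :
    ∃ z, momFeas c a g k z ∧ q ≤ -rieszFun z b := by
  let C : Set ((Fin m → ℝ) × ℝ) := {p | ∃ z, momFeas p.1 a g k z ∧ rieszFun z b ≤ p.2}
  have hCsmul : ∀ {r : ℝ} {p}, 0 ≤ r → p ∈ C → r • p ∈ C := by
    rintro r p hr ⟨z, hz, hb⟩
    refine ⟨r • z, momFeas_smul hz hr, ?_⟩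
    rw [rieszFun_smul]
    exact mul_le_mul_of_nonneg_left hb hr
  have hCconv : Convex ℝ C := by
    intro p hp p' hp' r r' hr hr' _
    obtain ⟨z, hz, hb⟩ := hCsmul hr hp
    obtain ⟨z', hz', hb'⟩ := hCsmul hr' hp'
    exact ⟨z + z', momFeas_add hz hz', (rieszFun_add z z' b).trans_le (add_le_add hb hb')⟩
  let P : (Fin n → ℝ) → (Fin m → ℝ) × ℝ := fun y => (fun i => eval y (a i), eval y b)
  have hPcont : Continuous P :=
    (continuous_pi fun i => continuous_eval (a i)).prodMk (continuous_eval b)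
  have hPC : ∀ y ∈ indexSet g, P y ∈ C := fun y hy =>
    ⟨_, momFeas_diracMoments a hy, (rieszFun_diracMoments y b).le⟩
  have hunitC : ((0, 1) : (Fin m → ℝ) × ℝ) ∈ C := by
    refine ⟨0, ⟨fun i => by simp [rieszFun], ?_, fun j => ?_⟩, by simp [rieszFun]⟩
    · exact Matrix.PosSemidef.zero
    · convert Matrix.PosSemidef.zero
      ext I J
      simp [localizingMat]
  let ℓ : ((Fin m → ℝ) × ℝ) →L[ℝ] ℝ :=
    (∑ i, x₀ i • ContinuousLinearMap.proj i) ∘L ContinuousLinearMap.fst ℝ _ _ +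
      ContinuousLinearMap.snd ℝ _ _
  have hℓ : ∀ p, ℓ p = (∑ i, x₀ i * p.1 i) + p.2 := fun p => by simp [ℓ]
  have hℓP : ∀ y ∈ indexSet g, 0 < ℓ (P y) := fun y hy => by rw [hℓ]; exact hx₀ y hy
  -- normalised generators of the cone
  let K : Set ((Fin m → ℝ) × ℝ) := insert (0, 1) ((fun y => (ℓ (P y))⁻¹ • P y) '' indexSet g)
  have hKC : K ⊆ C := by
    rintro p (rfl | ⟨y, hy, rfl⟩)
    · exact hunitC
    · exact hCsmul (inv_nonneg.2 (hℓP y hy).le) (hPC y hy)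
  have hKcomp : IsCompact K := by
    refine (hS.image_of_continuousOn ?_).insert _
    exact ((ℓ.continuous.comp hPcont).continuousOn.inv₀ fun y hy => (hℓP y hy).ne').smul
      hPcont.continuousOn
  have hKℓ : ∀ p ∈ K, ℓ p = 1 := by
    rintro p (rfl | ⟨y, hy, rfl⟩)
    · simp [hℓ]
    · rw [map_smul, smul_eq_mul, inv_mul_cancel₀ (hℓP y hy).ne']
  let w : (Fin m → ℝ) × ℝ := (c, -q)
  have hℓw : 0 < ℓ w := by
    have := hq x₀ fun y hy => (hx₀ y hy).le
    rw [hℓ]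
    simp only [w, mul_comm (x₀ _)]
    linarith
  suffices hmem : (ℓ w)⁻¹ • w ∈ convexHull ℝ K by
    have := hCsmul hℓw.le (convexHull_min hKC hCconv hmem)
    rw [smul_inv_smul₀ hℓw.ne'] at this
    obtain ⟨z, hz, hb⟩ := this
    exact ⟨z, hz, by simp only [w] at hb; linarith⟩
  by_contra hmem
  obtain ⟨f, u, hfw, hfK⟩ := geometric_hahn_banach_point_closed (convex_convexHull ℝ K)
    hKcomp.convexHull_of_finiteDimensional.isClosed hmem
  let F : ((Fin m → ℝ) × ℝ) →L[ℝ] ℝ := f - u • ℓ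
  have hFK : ∀ p ∈ K, 0 < F p := fun p hp => by
    have := hfK p (subset_convexHull ℝ K hp)
    simp only [F, sub_apply, smul_apply, hKℓ p hp]
    simpa using this
  have hFw : F w < 0 := by
    have h : F ((ℓ w)⁻¹ • w) < 0 := by
      have h1 : ℓ ((ℓ w)⁻¹ • w) = 1 := by rw [map_smul, smul_eq_mul, inv_mul_cancel₀ hℓw.ne']
      simp only [F, sub_apply, smul_apply, h1]
      simpa using hfw
    rw [map_smul, smul_eq_mul] at h
    exact (pos_iff_neg_of_mul_neg h).1 (inv_pos.2 hℓw)
  have hτ : 0 < F (0, 1) := hFK _ (Set.mem_insert _ _)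
  have hFP : ∀ y ∈ indexSet g, 0 < F (P y) := fun y hy => by
    have := hFK _ (Set.mem_insert_of_mem _ ⟨y, hy, rfl⟩)
    rw [map_smul, smul_eq_mul] at this
    exact (mul_pos_iff_of_pos_left (inv_pos.2 (hℓP y hy))).1 this
  have hF : ∀ p, F p = (∑ i, p.1 i * F (Pi.single i 1, 0)) + p.2 * F (0, 1) := by
    intro p
    have h1 : p = (∑ i, p.1 i • ((Pi.single i 1, 0) : (Fin m → ℝ) × ℝ)) + p.2 • (0, 1) := by
      refine Prod.ext ?_ ?_
      · simpa [Prod.fst_sum, ← Pi.single_smul] using (Finset.univ_sum_single p.1).symm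
      · simp [Prod.snd_sum]
    conv_lhs => rw [h1]
    simp only [map_add, map_sum, map_smul, smul_eq_mul]
  let x : Fin m → ℝ := fun i => F (Pi.single i 1, 0) / F (0, 1)
  have hFx : ∀ p, F p = F (0, 1) * ((∑ i, x i * p.1 i) + p.2) := by
    intro p
    rw [hF p, mul_add, Finset.mul_sum, mul_comm (F (0, 1)) p.2]
    congr 1
    refine Finset.sum_congr rfl fun i _ => ?_
    simp only [x]
    field_simp
  have hxfeas : isFeasible a b g x := fun y hy => by
    have := hFP y hy
    rw [hFx] at this
    exact ((mul_pos_iff_of_pos_left hτ).1 this).le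
  have hlt := hq x hxfeas
  rw [hFx] at hFw
  have hneg := (pos_iff_neg_of_mul_neg hFw).1 hτ
  simp only [w, mul_comm (x _)] at hneg
  linarith

/-- under the Archimedean and Slater conditions, if z* is an optimizer of
the k-th moment relaxation (k ≥ d_P) and the flat-truncation rank condition holds
(∃ t, d_P ≤ t ≤ k with rank M_{t−d_S}(z*) = rank M_t(z*)), then p^mom_k = p*. -/
theorem stmt7 {n m s : ℕ} (c : Fin m → ℝ) (a : Fin m → MvPolynomial (Fin n) ℝ)
    (b : MvPolynomial (Fin n) ℝ) (g : Fin s → MvPolynomial (Fin n) ℝ)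
    (pstar : ℝ)
    (hfeas : ∃ x, isFeasible a b g x)
    (hglb : IsGLB {v : ℝ | ∃ x, isFeasible a b g x ∧ v = ∑ i, c i * x i} pstar)
    (harch : QMArchimedean g)
    (hslater : ∃ x : Fin m → ℝ, ∀ y ∈ indexSet g,
      0 < (∑ i, x i * eval y (a i)) + eval y b)
    (k : ℕ) (hk : dP a b g ≤ k)
    (zstar : (Fin n →₀ ℕ) → ℝ)
    (hzfeas : momFeas c a g k zstar)
    (hzopt : ((-(rieszFun zstar b) : ℝ) : EReal) = pmom c a b g k)
    (hflat : ∃ t : ℕ, dP a b g ≤ t ∧ t ≤ k ∧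
      (momentMat n (t - dS g) zstar).rank = (momentMat n t zstar).rank) :
    pmom c a b g k = (pstar : EReal) := by
  apply le_antisymm
  · rw [← hzopt, EReal.coe_le_coe_iff]
    refine hglb.2 ?_
    rintro _ ⟨x, hx, rfl⟩
    obtain ⟨t, hdt, htk, hrank⟩ := hflat
    simp only [dP, max_le_iff, Finset.sup_le_iff, Finset.mem_univ, true_implies] at hdt
    obtain ⟨⟨hdS, hda⟩, hdb⟩ := hdt
    have hdeg : ((∑ i, x i • a i) + b).totalDegree ≤ 2 * t := by
      refine (totalDegree_add _ _).trans (max_le (totalDegree_finsetSum_le fun i _ =>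
        (totalDegree_smul_le _ _).trans ?_) ?_)
      · have := le_two_mul_halfCeil (a i).totalDegree
        have := hda i
        omega
      · have := le_two_mul_halfCeil b.totalDegree
        omega
    have hnonneg := rieszLin_nonneg_of_flat hzfeas.2.1 hzfeas.2.2 hdS htk hrank hdeg
      fun y hy => by simpa [smul_eval] using hx y hy
    simp only [map_add, map_sum, map_smul, ← rieszFun_eq_rieszLin, hzfeas.1, smul_eq_mul,
      mul_comm (x _)] at hnonneg
    linarith
  · obtain ⟨x₀, hx₀⟩ := hslater
    rw [← hzopt, EReal.coe_le_coe_iff]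
    refine le_of_forall_lt_imp_le_of_dense fun q hq => ?_
    obtain ⟨z, hz, hqz⟩ := exists_momFeas_of_slater (isCompact_indexSet harch) hx₀
      (fun x hx => hq.trans_le (hglb.1 ⟨x, hx, rfl⟩)) k
    have hle : ((-(rieszFun z b) : ℝ) : EReal) ≤ pmom c a b g k := le_sSup ⟨z, hz, rfl⟩
    rw [← hzopt, EReal.coe_le_coe_iff] at hle
    exact hqz.trans hle
end

section
/- The Slater condition holds for the homogenized LSIPP problem (i.e., there exists x̄ ∈ ℝ^m with a^h(ỹ)^T x̄ + b^h(ỹ) > 0 for all ỹ ∈ S̃) if and only if Condition 3 holds for (P): there exists x̄ ∈ ℝ^m with a(y)^T x̄ + b(y) > 0 for all y ∈ S and â(y)^T x̄ + b̂(y) > 0 for all y ∈ Ŝ. -/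
open MvPolynomial

/-- Homogenization of `f` to degree `D` with respect to the new variable Y₀
(the variable of index 0; the original variables Y_i become the variables of
index i.succ). -/
noncomputable def polyHomog {n : ℕ} (D : ℕ) (f : MvPolynomial (Fin n) ℝ) :
    MvPolynomial (Fin (n + 1)) ℝ :=
  ∑ α ∈ f.support,
    MvPolynomial.monomial
      (Finsupp.single (0 : Fin (n + 1)) (D - ∑ i, α i) + Finsupp.mapDomain Fin.succ α)
      (f.coeff α)

/-- The set S̃_> = {ỹ : g_j^h(ỹ) ≥ 0, y₀ > 0, ‖ỹ‖² = 1}. -/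
def tildeSPos {n s : ℕ} (g : Fin s → MvPolynomial (Fin n) ℝ) :
    Set (Fin (n + 1) → ℝ) :=
  {y | (∀ j, 0 ≤ eval y (polyHomog (g j).totalDegree (g j))) ∧ 0 < y 0 ∧
    ∑ i, y i ^ 2 = 1}

/-- The set S̃ = {ỹ : g_j^h(ỹ) ≥ 0, y₀ ≥ 0, ‖ỹ‖² = 1}. -/
def tildeS {n s : ℕ} (g : Fin s → MvPolynomial (Fin n) ℝ) :
    Set (Fin (n + 1) → ℝ) :=
  {y | (∀ j, 0 ≤ eval y (polyHomog (g j).totalDegree (g j))) ∧ 0 ≤ y 0 ∧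
    ∑ i, y i ^ 2 = 1}

/-- The set Ŝ = {y : ĝ_j(y) ≥ 0, ‖y‖² = 1}, where ĝ_j(y) = g_j^h(0, y). -/
def hatS {n s : ℕ} (g : Fin s → MvPolynomial (Fin n) ℝ) : Set (Fin n → ℝ) :=
  {y | (∀ j, 0 ≤ eval (Fin.cons 0 y) (polyHomog (g j).totalDegree (g j))) ∧
    ∑ i, y i ^ 2 = 1}

/-- ω = max{deg a₁, …, deg a_m, deg b}, the common homogenization degree. -/
def omegaDeg {n m : ℕ} (a : Fin m → MvPolynomial (Fin n) ℝ)
    (b : MvPolynomial (Fin n) ℝ) : ℕ :=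
  max (Finset.univ.sup fun i => (a i).totalDegree) b.totalDegree

/-- Homogenization recovers `f` on the ray through `(1, y)`, up to the factor `t ^ D`. -/
theorem eval_cons_polyHomog {n : ℕ} {D : ℕ} {f : MvPolynomial (Fin n) ℝ}
    (hD : f.totalDegree ≤ D) (t : ℝ) (y : Fin n → ℝ) :
    eval (Fin.cons t (t • y) : Fin (n + 1) → ℝ) (polyHomog D f) = t ^ D * eval y f := by
  rw [polyHomog, map_sum, eval_eq' y f, Finset.mul_sum]
  refine Finset.sum_congr rfl fun α hα => ?_
  have hdeg : ∑ i, α i ≤ D := by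
    have h := (le_totalDegree hα).trans hD
    rwa [Finsupp.sum_fintype _ _ fun _ => rfl] at h
  have h0 : Finsupp.mapDomain Fin.succ α (0 : Fin (n + 1)) = 0 :=
    Finsupp.mapDomain_of_notMem_range _ _ fun ⟨j, hj⟩ => Fin.succ_ne_zero j hj
  have hs : ∀ i : Fin n, Finsupp.mapDomain Fin.succ α i.succ = α i :=
    fun i => Finsupp.mapDomain_apply (Fin.succ_injective n) α i
  rw [eval_monomial, Finsupp.prod_fintype _ _ fun _ => pow_zero _, Fin.prod_univ_succ]
  simp only [Finsupp.add_apply, h0, hs, Finsupp.single_eq_same, Fin.cons_zero, Fin.cons_succ,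
    Finsupp.single_eq_of_ne (Fin.succ_ne_zero _), zero_add, add_zero, Pi.smul_apply,
    smul_eq_mul, mul_pow, Finset.prod_mul_distrib, Finset.prod_pow_eq_pow_sum]
  rw [← Nat.sub_add_cancel hdeg, pow_add, Nat.add_sub_cancel]
  ring

/-- The homogenized constraint function on the ray through `(1, y)`. -/
theorem constraint_eval_cons_polyHomog {n m : ℕ} (a : Fin m → MvPolynomial (Fin n) ℝ)
    (b : MvPolynomial (Fin n) ℝ) (x : Fin m → ℝ) (t : ℝ) (y : Fin n → ℝ) :
    (∑ i, x i * eval (Fin.cons t (t • y) : Fin (n + 1) → ℝ) (polyHomog (omegaDeg a b) (a i))) +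
        eval (Fin.cons t (t • y) : Fin (n + 1) → ℝ) (polyHomog (omegaDeg a b) b) =
      t ^ omegaDeg a b * ((∑ i, x i * eval y (a i)) + eval y b) := by
  have ha : ∀ i, (a i).totalDegree ≤ omegaDeg a b := fun i =>
    (Finset.le_sup (f := fun i => (a i).totalDegree) (Finset.mem_univ i)).trans (le_max_left _ _)
  have hb : b.totalDegree ≤ omegaDeg a b := le_max_right _ _
  rw [eval_cons_polyHomog hb, mul_add, Finset.mul_sum]
  congr 1
  refine Finset.sum_congr rfl fun i _ => ?_
  rw [eval_cons_polyHomog (ha i)]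
  ring

theorem cons_zero_mem_tildeS {n s : ℕ} {g : Fin s → MvPolynomial (Fin n) ℝ} {y : Fin n → ℝ} :
    (Fin.cons 0 y : Fin (n + 1) → ℝ) ∈ tildeS g ↔ y ∈ hatS g := by
  simp [tildeS, hatS, Fin.sum_univ_succ]

theorem cons_smul_mem_tildeS {n s : ℕ} {g : Fin s → MvPolynomial (Fin n) ℝ} {t : ℝ}
    (ht : 0 < t) {y : Fin n → ℝ} :
    (Fin.cons t (t • y) : Fin (n + 1) → ℝ) ∈ tildeS g ↔
      y ∈ indexSet g ∧ t ^ 2 * (1 + ∑ i, y i ^ 2) = 1 := by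
  have hg : ∀ j, 0 ≤ eval (Fin.cons t (t • y) : Fin (n + 1) → ℝ)
      (polyHomog (g j).totalDegree (g j)) ↔ 0 ≤ eval y (g j) := fun j => by
    rw [eval_cons_polyHomog le_rfl, mul_nonneg_iff_of_pos_left (pow_pos ht _)]
  simp [tildeS, indexSet, hg, Fin.sum_univ_succ, ht.le, mul_pow, mul_add, Finset.mul_sum]

/-- the Slater condition holds for the homogenized LSIPP problem if and
only if Condition 3 holds for (P). -/
theorem stmt13 {n m s : ℕ} (a : Fin m → MvPolynomial (Fin n) ℝ)
    (b : MvPolynomial (Fin n) ℝ) (g : Fin s → MvPolynomial (Fin n) ℝ) :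
    (∃ x : Fin m → ℝ, ∀ yt ∈ tildeS g,
        0 < (∑ i, x i * eval yt (polyHomog (omegaDeg a b) (a i))) +
          eval yt (polyHomog (omegaDeg a b) b)) ↔
      (∃ x : Fin m → ℝ,
        (∀ y ∈ indexSet g, 0 < (∑ i, x i * eval y (a i)) + eval y b) ∧
        (∀ y ∈ hatS g,
          0 < (∑ i, x i * eval (Fin.cons 0 y) (polyHomog (omegaDeg a b) (a i))) +
            eval (Fin.cons 0 y) (polyHomog (omegaDeg a b) b))) := by
  refine exists_congr fun x => ⟨fun h => ⟨fun y hy => ?_, fun y hy => ?_⟩,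
    fun ⟨hS, hhat⟩ yt hyt => ?_⟩
  · have hr : 0 < 1 + ∑ i, y i ^ 2 := by positivity
    have ht : 0 < (√(1 + ∑ i, y i ^ 2))⁻¹ := by positivity
    have hnorm : (√(1 + ∑ i, y i ^ 2))⁻¹ ^ 2 * (1 + ∑ i, y i ^ 2) = 1 := by
      rw [inv_pow, Real.sq_sqrt hr.le, inv_mul_cancel₀ hr.ne']
    have hpos := h _ ((cons_smul_mem_tildeS ht).2 ⟨hy, hnorm⟩)
    rw [constraint_eval_cons_polyHomog] at hpos
    exact (mul_pos_iff_of_pos_left (pow_pos ht _)).1 hpos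
  · exact h _ (cons_zero_mem_tildeS.2 hy)
  · obtain ⟨t, z, rfl⟩ : ∃ (t : ℝ) (z : Fin n → ℝ), yt = Fin.cons t z :=
      ⟨yt 0, Fin.tail yt, (Fin.cons_self_tail yt).symm⟩
    have ht : 0 ≤ t := by simpa using hyt.2.1
    rcases ht.eq_or_lt with rfl | ht
    · exact hhat z (cons_zero_mem_tildeS.1 hyt)
    · obtain ⟨y, rfl⟩ : ∃ y : Fin n → ℝ, z = t • y := ⟨t⁻¹ • z, (smul_inv_smul₀ ht.ne' z).symm⟩
      rw [constraint_eval_cons_polyHomog]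
      exact mul_pos (pow_pos ht _) (hS y ((cons_smul_mem_tildeS ht).1 hyt).1)
end
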